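/- Let k be a noetherian commutative ring and T an Ext-finite, strongly finitely generated, Karoubian k-linear triangulated category. A cohomological functor H: T^op → k-Mod is representable if and only if it is locally finite. -/

import Mathlib

open CategoryTheory CategoryTheory.Limits CategoryTheory.Pretriangulated

universe w v u

namespace Rouquier

variable {C : Type u} [Category.{v} C] [HasZeroObject C] [Preadditive C]
  [HasShift C ℤ] [∀ n : ℤ, (shiftFunctor C n).Additive] [Pretriangulated C]

/-- `Z` is a direct sum of `X` and `Y`, witnessed by the given injections and projections. -/
def IsDirSum {X Y Z : C} (i₁ : X ⟶ Z) (i₂ : Y ⟶ Z) (p₁ : Z ⟶ X) (p₂ : Z ⟶ Y) : Prop :=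
  i₁ ≫ p₁ = 𝟙 X ∧ i₂ ≫ p₂ = 𝟙 Y ∧ p₁ ≫ i₁ + p₂ ≫ i₂ = 𝟙 Z

/-- `⟨I⟩`, computed inside the full (triangulated) subcategory of objects satisfying `S` :
the closure of `I` under finite direct sums, direct summands and shifts. -/
inductive addHullIn (S : C → Prop) (I : C → Prop) : C → Prop
  | of {X : C} : I X → S X → addHullIn S I X
  | shift {X : C} (n : ℤ) : addHullIn S I X → S (X⟦n⟧) → addHullIn S I (X⟦n⟧)
  | sum {X Y Z : C} (i₁ : X ⟶ Z) (i₂ : Y ⟶ Z) (p₁ : Z ⟶ X) (p₂ : Z ⟶ Y) :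
      IsDirSum i₁ i₂ p₁ p₂ → addHullIn S I X → addHullIn S I Y → S Z → addHullIn S I Z
  | smd {X Y : C} (i : Y ⟶ X) (p : X ⟶ Y) :
      i ≫ p = 𝟙 Y → addHullIn S I X → S Y → addHullIn S I Y

/-- `I₁ ∗ I₂` computed inside `S` : objects `X` of `S` fitting in a distinguished triangle
`X₁ ⟶ X ⟶ X₂ ⟶ X₁⟦1⟧` with `X₁ ∈ I₁` and `X₂ ∈ I₂`. -/
def starIn (S I₁ I₂ : C → Prop) : C → Prop := fun X =>
  ∃ (X₁ X₂ : C) (f : X₁ ⟶ X) (g : X ⟶ X₂) (h : X₂ ⟶ X₁⟦(1 : ℤ)⟧),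
    S X ∧ I₁ X₁ ∧ I₂ X₂ ∧ Triangle.mk f g h ∈ distTriang C

/-- `⟨I⟩_d` computed inside `S`, defined by `⟨I⟩₀ = {0}` and
`⟨I⟩_d = ⟨I⟩_{d-1} ◇ ⟨I⟩ = ⟨⟨I⟩_{d-1} ∗ ⟨I⟩⟩`. -/
def hullStepIn (S I : C → Prop) : ℕ → C → Prop
  | 0 => fun X => IsZero X ∧ S X
  | d + 1 => addHullIn S (starIn S (hullStepIn S I d) (addHullIn S I))

/-- `⟨I⟩` : the closure of `I` under finite direct sums, direct summands and shifts. -/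
abbrev addHull (I : C → Prop) : C → Prop := addHullIn (fun _ => True) I

/-- `I₁ ∗ I₂`. -/
abbrev star (I₁ I₂ : C → Prop) : C → Prop := starIn (fun _ => True) I₁ I₂

/-- `⟨I⟩_d` for `d : ℕ`. -/
abbrev hullStep (I : C → Prop) : ℕ → C → Prop := hullStepIn (fun _ => True) I

/-- `⟨I⟩_∞ = ⋃_d ⟨I⟩_d`. -/
def hullOmega (I : C → Prop) : C → Prop := fun X => ∃ d : ℕ, hullStep I d X

/-- `⟨I⟩_d` for `d ∈ ℕ ∪ {∞}`. -/
def hullE (I : C → Prop) : ℕ∞ → C → Prop := fun e =>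
  e.recTopCoe (hullOmega I) (fun d => hullStep I d)

variable (C)

/-- The dimension of `C` is at most `d` : there is `M` with `C = ⟨M⟩_{d+1}`. -/
def DimLE (d : ℕ) : Prop := ∃ M : C, ∀ X : C, hullStep (fun Y => Y = M) (d + 1) X

/-- The dimension of the triangulated category `C`, an element of `ℕ ∪ {∞}` :
the least `d` such that `C = ⟨M⟩_{d+1}` for some object `M`. -/
noncomputable def trDim : ℕ∞ := ⨅ (d : ℕ) (_ : DimLE C d), (d : ℕ∞)

variable {C}

/-- The dimension of the full triangulated subcategory of objects satisfying `S`
is at most `d` : there is `M` in `S` with `S = ⟨M⟩_{d+1}`, the hull being computed in `S`. -/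
def SubDimLE (S : C → Prop) (d : ℕ) : Prop :=
  ∃ M : C, S M ∧ ∀ X : C, S X ↔ hullStepIn S (fun Y => Y = M) (d + 1) X

/-- The dimension of the full triangulated subcategory of objects satisfying `S`. -/
noncomputable def subDim (S : C → Prop) : ℕ∞ := ⨅ (d : ℕ) (_ : SubDimLE S d), (d : ℕ∞)

end Rouquier
namespace Rouquier

variable {k : Type w} [CommRing k]
variable {C : Type u} [Category.{v} C] [HasZeroObject C] [Preadditive C] [Linear k C]
  [HasShift C ℤ] [∀ n : ℤ, (shiftFunctor C n).Additive] [Pretriangulated C]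

/-- A functor `H : Cᵒᵖ ⥤ k-Mod` is cohomological if it sends distinguished triangles
`X ⟶ Y ⟶ Z ⟶ X⟦1⟧` to exact sequences `H(Z) ⟶ H(Y) ⟶ H(X)`. -/
def Cohomological (H : Cᵒᵖ ⥤ ModuleCat.{v} k) : Prop :=
  ∀ T : Triangle C, T ∈ (distTriang C) →
    Function.Exact (H.map T.mor₂.op) (H.map T.mor₁.op)

/-- `H` is locally finitely generated : for every `X` there are `D : C` and
`α : h_D ⟶ H` with `α(X⟦i⟧)` surjective for all `i : ℤ`. -/
def LocFinGen (H : Cᵒᵖ ⥤ ModuleCat.{v} k) : Prop :=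
  ∀ X : C, ∃ (D : C) (α : (linearYoneda k C).obj D ⟶ H),
    ∀ i : ℤ, Function.Surjective (α.app (Opposite.op (X⟦i⟧)))

/-- `H` is locally finitely presented : it is locally finitely generated, and the kernel
of any natural transformation `h_E ⟶ H` is locally finitely generated. -/
def LocFinPres (H : Cᵒᵖ ⥤ ModuleCat.{v} k) : Prop :=
  LocFinGen H ∧
  ∀ (E : C) (β : (linearYoneda k C).obj E ⟶ H) (X : C),
    ∃ (F : C) (f : F ⟶ E), (linearYoneda k C).map f ≫ β = 0 ∧
      ∀ (i : ℤ) (y : X⟦i⟧ ⟶ E), β.app (Opposite.op (X⟦i⟧)) y = 0 →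
        ∃ g : X⟦i⟧ ⟶ F, g ≫ f = y

end Rouquier

namespace Rouquier

section GradedModules

open DirectSum

variable {k : Type*} [CommRing k] {ι : Type*} {M : ι → Type*}
  [∀ i, AddCommGroup (M i)] [∀ i, Module k (M i)]

/-- A direct sum of modules is finitely generated if and only if all the summands are, and all
but finitely many of them vanish. -/
lemma finite_directSum_iff :
    Module.Finite k (⨁ i, M i) ↔
      (∀ i, Module.Finite k (M i)) ∧ {i | ¬ Subsingleton (M i)}.Finite := by
  classical
  constructor
  · intro h
    refine ⟨fun i => Module.Finite.of_surjective (component k ι M i)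
      fun x => ⟨lof k ι M i x, component.lof_self k i x⟩, ?_⟩
    obtain ⟨s, hs⟩ := h.fg_top
    refine (s.biUnion fun x => DFinsupp.support x).finite_toSet.subset fun i hi => ?_
    by_contra hi'
    refine hi (subsingleton_of_forall_eq 0 fun x => ?_)
    have hle : (⊤ : Submodule k (⨁ i, M i)) ≤ LinearMap.ker (component k ι M i) := by
      rw [← hs, Submodule.span_le]
      intro y hy
      by_contra hne
      exact hi' (Finset.mem_coe.2 (Finset.mem_biUnion.2
        ⟨y, hy, DFinsupp.mem_support_iff.2 hne⟩))
    rw [← component.lof_self k i x]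
    exact hle (Submodule.mem_top (x := lof k ι M i x))
  · rintro ⟨h, hfin⟩
    refine ⟨?_⟩
    have htop : (⊤ : Submodule k (⨁ i, M i)) =
        ⨆ i ∈ hfin.toFinset, LinearMap.range (lof k ι M i) := by
      refine (eq_top_iff.2 fun x _ => ?_).symm
      induction x using DirectSum.induction_on with
      | zero => exact zero_mem _
      | of i x =>
        by_cases hi : Subsingleton (M i)
        · rw [Subsingleton.elim x 0, map_zero]
          exact zero_mem _
        · exact Submodule.mem_iSup_of_mem i (Submodule.mem_iSup_of_mem (by simpa using hi) ⟨x, rfl⟩)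
      | add x y hx hy => exact add_mem (hx trivial) (hy trivial)
    rw [htop]
    refine Submodule.fg_biSup _ _ fun i _ => ?_
    rw [LinearMap.range_eq_map]
    exact (h i).fg_top.map _

/-- A family of finitely generated submodules, all but finitely many of them inside zero modules,
is generated by finitely many elements. -/
lemma exists_finset_generators [IsNoetherianRing k] (h : ∀ i, Module.Finite k (M i))
    (hfin : {i | ¬ Subsingleton (M i)}.Finite) (N : ∀ i, Submodule k (M i)) :
    ∃ S : Finset (Σ i, M i), (∀ p ∈ S, p.2 ∈ N p.1) ∧
      ∀ i, N i ≤ Submodule.span k {x | (⟨i, x⟩ : Σ i, M i) ∈ S} := by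
  classical
  have hN (i : ι) : (N i).FG := IsNoetherian.noetherian (N i)
  choose s hs using hN
  refine ⟨hfin.toFinset.sigma s, ?_, fun i => ?_⟩
  · rintro ⟨i, x⟩ hp
    rw [Finset.mem_sigma] at hp
    rw [← hs]
    exact Submodule.subset_span hp.2
  · by_cases hi : Subsingleton (M i)
    · intro x _
      rw [Subsingleton.elim x 0]
      exact zero_mem _
    · rw [← hs]
      exact Submodule.span_mono fun x hx => by simpa [hi] using hx

end GradedModules

section Presheaves

variable {k : Type w} [CommRing k] {C : Type u} [Category.{v} C]

/-- The restriction map `H(Y) ⟶ H(X)` along `f : X ⟶ Y`. -/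
def pull (H : Cᵒᵖ ⥤ ModuleCat.{v} k) {X Y : C} (f : X ⟶ Y) :
    H.obj (Opposite.op Y) →ₗ[k] H.obj (Opposite.op X) := (H.map f.op).hom

variable (H : Cᵒᵖ ⥤ ModuleCat.{v} k)

@[simp]
lemma pull_id (X : C) (x : H.obj (Opposite.op X)) : pull H (𝟙 X) x = x := by
  simp [pull]

@[simp]
lemma pull_comp {X Y Z : C} (f : X ⟶ Y) (g : Y ⟶ Z) (x : H.obj (Opposite.op Z)) :
    pull H (f ≫ g) x = pull H f (pull H g x) := by
  simp [pull]

variable [Preadditive C] [H.Additive]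

lemma pull_add {X Y : C} (f g : X ⟶ Y) (x : H.obj (Opposite.op Y)) :
    pull H (f + g) x = pull H f x + pull H g x := by
  simp [pull, op_add, Functor.map_add]

@[simp]
lemma pull_zero {X Y : C} (x : H.obj (Opposite.op Y)) :
    pull H (0 : X ⟶ Y) x = 0 := by
  simp [pull, op_zero, Functor.map_zero]

lemma pull_sub {X Y : C} (f g : X ⟶ Y) (x : H.obj (Opposite.op Y)) :
    pull H (f - g) x = pull H f x - pull H g x := by
  rw [eq_sub_iff_add_eq, ← pull_add, sub_add_cancel]

/-- The element `a : H(D)` as a `k`-linear map `Hom(X, D) ⟶ H(X)`. -/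
def evalAt [Linear k C]
    (hlin : ∀ (X Y : C) (c : k) (f : X ⟶ Y), H.map (c • f).op = c • H.map f.op)
    {D : C} (a : H.obj (Opposite.op D)) (X : C) : (X ⟶ D) →ₗ[k] H.obj (Opposite.op X) where
  toFun f := pull H f a
  map_add' f g := pull_add H f g a
  map_smul' c f := by simp [pull, hlin]

@[simp]
lemma evalAt_apply [Linear k C]
    (hlin : ∀ (X Y : C) (c : k) (f : X ⟶ Y), H.map (c • f).op = c • H.map f.op)
    {D : C} (a : H.obj (Opposite.op D)) {X : C} (f : X ⟶ D) :
    evalAt H hlin a X f = pull H f a := rfl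

/-- Finitely many elements of `H` are restrictions of a single one, on a biproduct. -/
lemma exists_pull_biproduct_ι {ι : Type*} [Finite ι] (X : ι → C) [HasBiproduct X]
    (x : ∀ i, H.obj (Opposite.op (X i))) :
    ∃ a : H.obj (Opposite.op (biproduct X)), ∀ i, pull H (biproduct.ι X i) a = x i := by
  classical
  have := Fintype.ofFinite ι
  refine ⟨∑ i, pull H (biproduct.π X i) (x i), fun i => ?_⟩
  rw [map_sum, Finset.sum_eq_single i]
  · rw [← pull_comp, biproduct.ι_π_self, pull_id]
  · intro j _ hj
    rw [← pull_comp, biproduct.ι_π_ne X hj.symm, pull_zero]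
  · simp

/-- An element of `H` on a finite biproduct vanishes as soon as its restrictions do. -/
lemma eq_zero_of_pull_biproduct_ι {ι : Type*} [Finite ι] (X : ι → C) [HasBiproduct X]
    (a : H.obj (Opposite.op (biproduct X))) (ha : ∀ i, pull H (biproduct.ι X i) a = 0) :
    a = 0 := by
  have := Fintype.ofFinite ι
  have hsum (s : Finset ι) : pull H (∑ i ∈ s, biproduct.π X i ≫ biproduct.ι X i) a = 0 := by
    classical
    induction s using Finset.induction_on with
    | empty => simp
    | insert i s hi ih => rw [Finset.sum_insert hi, pull_add, ih, pull_comp, ha, map_zero, add_zero]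
  have htotal : ∑ i, biproduct.π X i ≫ biproduct.ι X i = 𝟙 (biproduct X) := by
    classical
    refine biproduct.hom_ext' _ _ fun j => ?_
    rw [Preadditive.comp_sum, Finset.sum_eq_single j]
    · simp
    · intro i _ hi
      rw [biproduct.ι_π_ne_assoc X hi.symm, zero_comp]
    · simp
  rw [← pull_id H _ a, ← htotal]
  exact hsum _

/-- If `a : H(D)` generates `H`, and `φ : D ⟶ D'` kills the kernel of `a` while `a` extends
along `φ`, then `H` is representable. -/
lemma representable_of_split [Linear k C] [IsIdempotentComplete C]
    (hlin : ∀ (X Y : C) (c : k) (f : X ⟶ Y), H.map (c • f).op = c • H.map f.op)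
    {D D' : C} (a : H.obj (Opposite.op D)) (a' : H.obj (Opposite.op D')) (φ : D ⟶ D')
    (hφ : pull H φ a' = a)
    (hsurj : ∀ (X : C) (x : H.obj (Opposite.op X)), ∃ f : X ⟶ D, pull H f a = x)
    (hker : ∀ (X : C) (f : X ⟶ D), pull H f a = 0 → f ≫ φ = 0) :
    ∃ E : C, Nonempty (H ≅ (linearYoneda k C).obj E) := by
  obtain ⟨s, hs⟩ := hsurj D' a'
  have hidem : (s ≫ φ) ≫ (s ≫ φ) = s ≫ φ := by
    have h := hker D' (s ≫ φ ≫ s - s) (by simp [pull_sub, hs, hφ])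
    rw [Preadditive.sub_comp, sub_eq_zero] at h
    simpa using h
  obtain ⟨E, i, p, hip, hpi⟩ := IsIdempotentComplete.idempotents_split D' (s ≫ φ) hidem
  have hinj (X : C) : Function.Injective (evalAt H hlin (pull H i a') X) := by
    rw [injective_iff_map_eq_zero]
    intro f hf
    have h := hker X (f ≫ i ≫ s) (by simpa [hs] using hf)
    have h' : f ≫ i ≫ p ≫ i = 0 := by simpa [hpi] using h
    have h'' := congrArg (· ≫ p) h'
    simpa [hip] using h''
  have hsur (X : C) : Function.Surjective (evalAt H hlin (pull H i a') X) := by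
    intro x
    obtain ⟨g, rfl⟩ := hsurj X x
    refine ⟨g ≫ φ ≫ p, ?_⟩
    rw [evalAt_apply, ← pull_comp, Category.assoc, Category.assoc, hpi]
    simp [hφ, hs]
  refine ⟨E, ⟨NatIso.ofComponents (fun X =>
    (LinearEquiv.ofBijective (evalAt H hlin (pull H i a') X.unop)
      ⟨hinj X.unop, hsur X.unop⟩).toModuleIso) (fun {X Y} f => ?_) |>.symm⟩⟩
  ext g
  exact pull_comp H f.unop g _

end Presheaves

section Towers

variable {k : Type w} [CommRing k]
variable {C : Type u} [Category.{v} C] [Preadditive C]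
  (H : Cᵒᵖ ⥤ ModuleCat.{v} k) (F : ℕ ⥤ C) (a : ∀ n, H.obj (Opposite.op (F.obj n)))

/-- On `X`, the tower `F` with its compatible elements `a` approximates `H`: the kernel of
`Hom(X, F i) ⟶ H(X)` dies after `d` steps, and this map is surjective for `e ≤ i`. -/
structure Approximates (d e : ℕ) (X : C) : Prop where
  comp_eq_zero : ∀ (i : ℕ) (f : X ⟶ F.obj i), pull H f (a i) = 0 →
    f ≫ F.map (homOfLE (Nat.le_add_right i d)) = 0
  exists_pull_eq : ∀ (i : ℕ), e ≤ i → ∀ x : H.obj (Opposite.op X),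
    ∃ f : X ⟶ F.obj i, pull H f (a i) = x

variable {H F a} {d e : ℕ}

lemma Approximates.of_retract {X Y : C} (hX : Approximates H F a d e X) (i : Y ⟶ X) (p : X ⟶ Y)
    (hip : i ≫ p = 𝟙 Y) : Approximates H F a d e Y where
  comp_eq_zero j f hf := by
    have h := hX.comp_eq_zero j (p ≫ f) (by rw [pull_comp, hf, map_zero])
    rw [Category.assoc] at h
    rw [← Category.id_comp f, ← hip, Category.assoc, Category.assoc, h, comp_zero]
  exists_pull_eq j hj x := by
    obtain ⟨f, hf⟩ := hX.exists_pull_eq j hj (pull H p x)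
    exact ⟨i ≫ f, by rw [pull_comp, hf, ← pull_comp, hip, pull_id]⟩

lemma Approximates.of_isDirSum [H.Additive] {X Y Z : C} (hX : Approximates H F a d e X)
    (hY : Approximates H F a d e Y) {i₁ : X ⟶ Z} {i₂ : Y ⟶ Z} {p₁ : Z ⟶ X} {p₂ : Z ⟶ Y}
    (h : p₁ ≫ i₁ + p₂ ≫ i₂ = 𝟙 Z) : Approximates H F a d e Z where
  comp_eq_zero j f hf := by
    have h₁ := hX.comp_eq_zero j (i₁ ≫ f) (by rw [pull_comp, hf, map_zero])
    have h₂ := hY.comp_eq_zero j (i₂ ≫ f) (by rw [pull_comp, hf, map_zero])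
    rw [Category.assoc] at h₁ h₂
    rw [← Category.id_comp f, ← h]
    simp [h₁, h₂]
  exists_pull_eq j hj x := by
    obtain ⟨f, hf⟩ := hX.exists_pull_eq j hj (pull H i₁ x)
    obtain ⟨g, hg⟩ := hY.exists_pull_eq j hj (pull H i₂ x)
    refine ⟨p₁ ≫ f + p₂ ≫ g, ?_⟩
    rw [pull_add, pull_comp, pull_comp, hf, hg, ← pull_comp, ← pull_comp, ← pull_add, h, pull_id]

lemma Approximates.of_isZero [H.Additive] {X : C} (hX : IsZero X) : Approximates H F a d e X where
  comp_eq_zero _ _ _ := hX.eq_of_src _ _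
  exists_pull_eq _ _ x := ⟨0, by rw [← pull_id H X x, hX.eq_of_src (𝟙 X) 0]; simp⟩

variable [HasShift C ℤ] [∀ n : ℤ, (shiftFunctor C n).Additive]

lemma approximates_of_addHull [H.Additive] {I : C → Prop}
    (hI : ∀ X, I X → ∀ n : ℤ, Approximates H F a d e (X⟦n⟧)) {X : C} (hX : addHull I X) (n : ℤ) :
    Approximates H F a d e (X⟦n⟧) := by
  induction hX generalizing n with
  | of h _ => exact hI _ h n
  | shift m _ _ ih =>
    exact (ih (m + n)).of_retract ((shiftFunctorAdd C m n).inv.app _)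
      ((shiftFunctorAdd C m n).hom.app _) (by simp)
  | sum i₁ i₂ p₁ p₂ h _ _ _ ih₁ ih₂ =>
    refine (ih₁ n).of_isDirSum (ih₂ n) (i₁ := i₁⟦n⟧') (i₂ := i₂⟦n⟧') (p₁ := p₁⟦n⟧')
      (p₂ := p₂⟦n⟧') ?_
    rw [← Functor.map_comp, ← Functor.map_comp, ← Functor.map_add, h.2.2,
      CategoryTheory.Functor.map_id]
  | smd i p h _ _ ih =>
    exact (ih n).of_retract (i⟦n⟧') (p⟦n⟧')
      (by rw [← Functor.map_comp, h, CategoryTheory.Functor.map_id])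

variable [HasZeroObject C] [Pretriangulated C]

/-- The dévissage step: approximation passes to extensions. -/
lemma Approximates.of_distTriang [H.Additive] (hH : Cohomological H)
    (ha : ∀ i j (h : i ≤ j), pull H (F.map (homOfLE h)) (a j) = a i)
    (T : Triangle C) (hT : T ∈ distTriang C)
    (h₁ : Approximates H F a d d T.obj₁) (h₁' : Approximates H F a d d (T.obj₁⟦(1 : ℤ)⟧))
    (h₃ : Approximates H F a 1 0 T.obj₃) (h₃' : Approximates H F a 1 0 (T.obj₃⟦(-1 : ℤ)⟧)) :
    Approximates H F a (d + 1) (d + 1) T.obj₂ where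
  comp_eq_zero i f hf := by
    have h := h₁.comp_eq_zero i (T.mor₁ ≫ f) (by rw [pull_comp, hf, map_zero])
    rw [Category.assoc] at h
    obtain ⟨z, hz⟩ := T.yoneda_exact₂ hT _ h
    have hz0 : pull H T.mor₂ (pull H z (a (i + d))) = 0 := by
      rw [← pull_comp, ← hz, pull_comp, ha, hf]
    obtain ⟨y, hy⟩ := (hH _ (rot_of_distTriang _ hT) _).1 hz0
    obtain ⟨w, hw⟩ := h₁'.exists_pull_eq (i + d) (Nat.le_add_left d i) y
    have hzw := h₃.comp_eq_zero (i + d) (z - T.mor₃ ≫ w) (by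
      rw [pull_sub, pull_comp, hw, sub_eq_zero]
      exact hy.symm)
    have hmap : F.map (homOfLE (Nat.le_add_right i (d + 1))) =
        F.map (homOfLE (Nat.le_add_right i d)) ≫
          F.map (homOfLE (Nat.le_add_right (i + d) 1)) := by
      rw [← F.map_comp]
      rfl
    rw [Preadditive.sub_comp, sub_eq_zero] at hzw
    rw [hmap, ← Category.assoc, hz, Category.assoc, hzw, Category.assoc, ← Category.assoc,
      comp_distTriang_mor_zero₂₃ _ hT, zero_comp]
  exists_pull_eq j hj x := by
    obtain ⟨j, rfl⟩ : ∃ j', j = j' + 1 := ⟨j - 1, by lia⟩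
    obtain ⟨y, hy⟩ := h₁.exists_pull_eq j (by lia) (pull H T.mor₁ x)
    let δ : T.obj₃⟦(-1 : ℤ)⟧ ⟶ T.obj₁ := T.invRotate.mor₁
    have hδ : δ ≫ T.mor₁ = 0 := comp_distTriang_mor_zero₁₂ _ (inv_rot_of_distTriang _ hT)
    have h := h₃'.comp_eq_zero j (δ ≫ y) (by rw [pull_comp, hy, ← pull_comp, hδ, pull_zero])
    rw [Category.assoc] at h
    obtain ⟨z, hz⟩ : ∃ z : T.obj₂ ⟶ F.obj (j + 1),
        y ≫ F.map (homOfLE (Nat.le_add_right j 1)) = T.mor₁ ≫ z :=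
      T.invRotate.yoneda_exact₂ (inv_rot_of_distTriang _ hT) _ h
    have hx0 : pull H T.mor₁ (x - pull H z (a (j + 1))) = 0 := by
      rw [map_sub, ← pull_comp, ← hz, pull_comp, ha, hy, sub_self]
    obtain ⟨t, ht⟩ := (hH _ hT _).1 hx0
    obtain ⟨r, hr⟩ := h₃.exists_pull_eq (j + 1) (Nat.zero_le _) t
    refine ⟨z + T.mor₂ ≫ r, ?_⟩
    rw [pull_add, pull_comp, hr]
    exact (congrArg (_ + ·) ht).trans (add_sub_cancel _ _)

lemma approximates_of_hullStep [H.Additive] (hH : Cohomological H)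
    (ha : ∀ i j (h : i ≤ j), pull H (F.map (homOfLE h)) (a j) = a i) {I : C → Prop}
    (hI : ∀ X, I X → ∀ n : ℤ, Approximates H F a 1 0 (X⟦n⟧)) (d : ℕ) {X : C}
    (hX : hullStep I d X) (n : ℤ) : Approximates H F a d d (X⟦n⟧) := by
  induction d generalizing X n with
  | zero => exact .of_isZero ((shiftFunctor C n).map_isZero hX.1)
  | succ d ih =>
    refine approximates_of_addHull ?_ hX n
    rintro X ⟨X₁, X₂, f, g, h, -, hX₁, hX₂, hT⟩ n
    have h₃ := approximates_of_addHull hI hX₂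
    exact .of_distTriang hH ha _ (Triangle.shift_distinguished _ hT n) (ih hX₁ n)
      ((ih hX₁ (n + 1)).of_retract ((shiftFunctorAdd C n 1).inv.app X₁)
        ((shiftFunctorAdd C n 1).hom.app X₁) (Iso.inv_hom_id_app _ _))
      (h₃ n)
      ((h₃ (n + -1)).of_retract ((shiftFunctorAdd C n (-1)).inv.app X₂)
        ((shiftFunctorAdd C n (-1)).hom.app X₂) (Iso.inv_hom_id_app _ _))

end Towers

section Finiteness

variable {k : Type w} [CommRing k]
variable {C : Type u} [Category.{v} C] [Preadditive C] [Linear k C]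
  [HasShift C ℤ] [∀ n : ℤ, (shiftFunctor C n).Additive]

/-- In an Ext-finite category, representable functors are locally finite. -/
lemma finite_hom_shift
    (hext : ∀ X Y : C, Module.Finite k (DirectSum ℤ fun i => (X ⟶ (Y⟦i⟧)))) (X D : C) :
    (∀ i : ℤ, Module.Finite k (X⟦i⟧ ⟶ D)) ∧ {i : ℤ | ¬ Subsingleton (X⟦i⟧ ⟶ D)}.Finite := by
  constructor
  · intro i
    have := (finite_directSum_iff.1 (hext (X⟦i⟧) D)).1 0
    exact Module.Finite.of_surjective
      (Linear.rightComp k (X⟦i⟧) ((shiftFunctorZero C ℤ).hom.app D))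
      fun f => ⟨f ≫ (shiftFunctorZero C ℤ).inv.app D, by simp⟩
  · refine (((finite_directSum_iff.1 (hext X D)).2).preimage
      (f := fun i : ℤ => -i) neg_injective.injOn).subset fun i hi hi' => hi ?_
    refine subsingleton_of_forall_eq 0 fun f => (shiftFunctor C (-i)).map_injective ?_
    rw [Functor.map_zero, ← cancel_epi ((shiftShiftNeg X i).inv)]
    exact Subsingleton.elim _ _

variable [HasZeroObject C] [Pretriangulated C] (H : Cᵒᵖ ⥤ ModuleCat.{v} k) [H.Additive]

lemma exists_generator [IsNoetherianRing k]
    (hlin : ∀ (X Y : C) (c : k) (f : X ⟶ Y), H.map (c • f).op = c • H.map f.op)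
    (G : C)
    (hfin : Module.Finite k (DirectSum ℤ fun i => H.obj (Opposite.op (G⟦i⟧)))) :
    ∃ (D : C) (a : H.obj (Opposite.op D)), ∀ (n : ℤ) (x : H.obj (Opposite.op (G⟦n⟧))),
      ∃ f : G⟦n⟧ ⟶ D, pull H f a = x := by
  have hfin' := finite_directSum_iff.1 hfin
  obtain ⟨S, -, hS⟩ := exists_finset_generators hfin'.1 hfin'.2 fun _ => ⊤
  obtain ⟨a, ha⟩ := exists_pull_biproduct_ι H (fun p : S => G⟦p.1.1⟧) fun p => p.1.2
  refine ⟨_, a, fun n x => ?_⟩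
  have hle : Submodule.span k {x | (⟨n, x⟩ : Σ i : ℤ, H.obj (Opposite.op (G⟦i⟧))) ∈ S} ≤
      LinearMap.range (evalAt H hlin a (G⟦n⟧)) :=
    Submodule.span_le.2 fun y hy => ⟨_, ha ⟨⟨n, y⟩, hy⟩⟩
  exact hle (hS n Submodule.mem_top)

lemma exists_next [IsNoetherianRing k]
    (hlin : ∀ (X Y : C) (c : k) (f : X ⟶ Y), H.map (c • f).op = c • H.map f.op)
    (hH : Cohomological H)
    (hext : ∀ X Y : C, Module.Finite k (DirectSum ℤ fun i => (X ⟶ (Y⟦i⟧)))) (G : C)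
    {D : C} (a : H.obj (Opposite.op D)) :
    ∃ (D' : C) (a' : H.obj (Opposite.op D')) (φ : D ⟶ D'), pull H φ a' = a ∧
      ∀ (n : ℤ) (f : G⟦n⟧ ⟶ D), pull H f a = 0 → f ≫ φ = 0 := by
  have hfin := finite_hom_shift hext G D
  obtain ⟨S, hSker, hS⟩ := exists_finset_generators hfin.1 hfin.2
    fun n => LinearMap.ker (evalAt H hlin a (G⟦n⟧))
  let π : biproduct (fun p : S => G⟦p.1.1⟧) ⟶ D := biproduct.desc fun p => p.1.2
  have hπ : pull H π a = 0 := by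
    refine eq_zero_of_pull_biproduct_ι H _ _ fun p => ?_
    rw [← pull_comp, biproduct.ι_desc]
    exact hSker p.1 p.2
  obtain ⟨D', φ, δ, hT⟩ := distinguished_cocone_triangle π
  obtain ⟨a', ha'⟩ := (hH _ hT a).1 hπ
  refine ⟨D', a', φ, ha', fun n f hf => ?_⟩
  have hle : Submodule.span k {f | (⟨n, f⟩ : Σ i : ℤ, (G⟦i⟧ ⟶ D)) ∈ S} ≤
      LinearMap.ker (Linear.rightComp k (G⟦n⟧) φ) := by
    refine Submodule.span_le.2 fun f hf => ?_
    have h : f = biproduct.ι (fun p : S => G⟦p.1.1⟧) ⟨⟨n, f⟩, hf⟩ ≫ π := by simp [π]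
    have h0 : π ≫ φ = 0 := comp_distTriang_mor_zero₁₂ _ hT
    change f ≫ φ = 0
    rw [h, Category.assoc, h0, comp_zero]
  exact hle (hS n hf)

/-- A locally finite cohomological functor is approximated on the shifts of `G` by a tower. -/
lemma exists_tower [IsNoetherianRing k]
    (hlin : ∀ (X Y : C) (c : k) (f : X ⟶ Y), H.map (c • f).op = c • H.map f.op)
    (hH : Cohomological H)
    (hext : ∀ X Y : C, Module.Finite k (DirectSum ℤ fun i => (X ⟶ (Y⟦i⟧)))) (G : C)
    (hfin : Module.Finite k (DirectSum ℤ fun i => H.obj (Opposite.op (G⟦i⟧)))) :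
    ∃ (F : ℕ ⥤ C) (a : ∀ n, H.obj (Opposite.op (F.obj n))),
      (∀ i j (h : i ≤ j), pull H (F.map (homOfLE h)) (a j) = a i) ∧
      ∀ n : ℤ, Approximates H F a 1 0 (G⟦n⟧) := by
  obtain ⟨D₀, a₀, h₀⟩ := exists_generator H hlin G hfin
  choose D₁ a₁ φ hφ hφker using
    fun D : Σ D : C, H.obj (Opposite.op D) => exists_next H hlin hH hext G D.2
  let P : ℕ → Σ D : C, H.obj (Opposite.op D) :=
    fun n => Nat.rec ⟨D₀, a₀⟩ (fun _ D => ⟨D₁ D, a₁ D⟩) n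
  let F : ℕ ⥤ C := Functor.ofSequence (X := fun n => (P n).1) fun n => φ (P n)
  have hF (n : ℕ) : F.map (homOfLE (Nat.le_add_right n 1)) = φ (P n) :=
    Functor.ofSequence_map_homOfLE_succ _ n
  let a (n : ℕ) : H.obj (Opposite.op (F.obj n)) := (P n).2
  have ha : ∀ i j (h : i ≤ j), pull H (F.map (homOfLE h)) (a j) = a i := by
    intro i j h
    induction j, h using Nat.le_induction with
    | base => exact (congrArg (fun f => pull H f (a i)) (F.map_id i)).trans (pull_id H _ _)
    | succ j h ih =>
      have hmap : F.map (homOfLE (h.trans (Nat.le_add_right j 1))) =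
          F.map (homOfLE h) ≫ F.map (homOfLE (Nat.le_add_right j 1)) := by
        rw [← F.map_comp]
        rfl
      have hj : pull H (F.map (homOfLE (Nat.le_add_right j 1))) (a (j + 1)) = a j := by
        rw [hF]
        exact hφ (P j)
      rw [hmap, pull_comp, hj, ih]
  refine ⟨F, a, ha, fun n => ⟨fun i f hf => ?_, fun i _ x => ?_⟩⟩
  · rw [hF]
    exact hφker (P i) n f hf
  · obtain ⟨f, hf⟩ := h₀ n x
    let f₀ : G⟦n⟧ ⟶ F.obj 0 := f
    refine ⟨f₀ ≫ F.map (homOfLE (Nat.zero_le i)), ?_⟩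
    rw [pull_comp, ha]
    exact hf

end Finiteness

end Rouquier

namespace Rouquier

open DirectSum

/-- **Rouquier, Corollary 4.18 (Bondal–Van den Bergh representability).** Let `k` be a
noetherian commutative ring and `T` an Ext-finite, strongly finitely generated, Karoubian
`k`-linear triangulated category. A cohomological functor `H : Tᵒᵖ ⥤ k-Mod` is
representable if and only if it is locally finite. -/
theorem representable_iff_locally_finite
    {k : Type w} [CommRing k] [IsNoetherianRing k]
    {C : Type u} [Category.{v} C] [HasZeroObject C] [Preadditive C] [Linear k C]
    [HasShift C ℤ] [∀ n : ℤ, (shiftFunctor C n).Additive] [Pretriangulated C]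
    (hext : ∀ X Y : C, Module.Finite k (⨁ i : ℤ, (X ⟶ (Y⟦i⟧))))
    (hsfg : ∃ (G : C) (d : ℕ), ∀ X : C, hullStep (fun Y => Y = G) d X)
    [IsIdempotentComplete C]
    (H : Cᵒᵖ ⥤ ModuleCat.{v} k) [H.Additive]
    (hlin : ∀ (X Y : C) (c : k) (f : X ⟶ Y), H.map (c • f).op = c • H.map f.op)
    (hH : Cohomological H) :
    (∃ D : C, Nonempty (H ≅ (linearYoneda k C).obj D)) ↔
      ∀ X : C, Module.Finite k (⨁ i : ℤ, ↥(H.obj (Opposite.op (X⟦i⟧)))) := by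
  constructor
  · rintro ⟨D, ⟨e⟩⟩ X
    have hfin := finite_hom_shift hext X D
    have e' (i : ℤ) : (X⟦i⟧ ⟶ D) ≃ₗ[k] H.obj (Opposite.op (X⟦i⟧)) :=
      (e.symm.app (Opposite.op (X⟦i⟧))).toLinearEquiv
    refine finite_directSum_iff.2 ⟨fun i => ?_, hfin.2.subset fun i hi hi' => hi ?_⟩
    · have := hfin.1 i
      exact Module.Finite.equiv (e' i)
    · exact (e' i).symm.toEquiv.subsingleton
  · intro hfin
    obtain ⟨G, d, hG⟩ := hsfg
    obtain ⟨F, a, ha, hFG⟩ := exists_tower H hlin hH hext G (hfin G)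
    have happ (X : C) : Approximates H F a d d X :=
      (approximates_of_hullStep hH ha (by rintro _ rfl n; exact hFG n) d (hG X) 0).of_retract
        ((shiftFunctorZero C ℤ).inv.app X) ((shiftFunctorZero C ℤ).hom.app X) (by simp)
    exact representable_of_split H hlin (a d) (a (d + d)) _ (ha d (d + d) (Nat.le_add_left d d))
      (fun X => (happ X).exists_pull_eq d le_rfl) (fun X => (happ X).comp_eq_zero d)

end Rouquier
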